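/- arXiv:2007.15387 — 2 statements merged into one kernel-verified Lean document; each statement's English description precedes it below -/
import Mathlib

section
/- For all κ, T₁, T₂ > 0 one has 0 < C₁ < 1, 0 < C₂ < 1, and 1 − C₁C₂ ≤ √(π/2) · (1/(κ√T₁) + 1/(κ√T₂)); consequently 1/(1 − C₁C₂) ≥ √(2/π) · κ √(T₁T₂)/(√T₁ + √T₂). -/
open MeasureTheory Real Set

/-- Centered Maxwellian with temperature `T`: `M_T(v) = (2πT)^{-1/2} exp(−v²/(2T))`. -/
noncomputable def Mxw (T v : ℝ) : ℝ :=
  (Real.sqrt (2 * π * T))⁻¹ * Real.exp (-v ^ 2 / (2 * T))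

/-- Wall Maxwellian with temperature `T`: `M̃_T(v) = (1/T) exp(−v²/(2T))`,
normalized so that `∫₀^∞ v M̃_T(v) dv = 1`. -/
noncomputable def wallMxw (T v : ℝ) : ℝ :=
  T⁻¹ * Real.exp (-v ^ 2 / (2 * T))

/-- `C_i = ∫₀^∞ v e^{−1/(κv)} M̃_{T_i}(v) dv`. -/
noncomputable def Cwall (κ T : ℝ) : ℝ :=
  ∫ v in Ioi (0 : ℝ), v * Real.exp (-1 / (κ * v)) * wallMxw T v

/-- `C₋ = (1/κ) ∫₀¹ ρ(y) (∫₀^∞ e^{−y/(κv)} M_{T(y)}(v) dv) dy`. -/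
noncomputable def Cminus (κ : ℝ) (ρ T : ℝ → ℝ) : ℝ :=
  κ⁻¹ * ∫ y in Icc (0 : ℝ) 1, ρ y * ∫ v in Ioi (0 : ℝ), Real.exp (-y / (κ * v)) * Mxw (T y) v

/-- `C₊ = (1/κ) ∫₀¹ ρ(y) (∫₀^∞ e^{−(1−y)/(κv)} M_{T(y)}(v) dv) dy`. -/
noncomputable def Cplus (κ : ℝ) (ρ T : ℝ → ℝ) : ℝ :=
  κ⁻¹ * ∫ y in Icc (0 : ℝ) 1, ρ y * ∫ v in Ioi (0 : ℝ), Real.exp (-(1 - y) / (κ * v)) * Mxw (T y) v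

/-- `f` is a mild steady state of the linear BGK equation with data `(κ, T₁, T₂, ρ, T)`. -/
def IsMildSteadyState (κ T₁ T₂ : ℝ) (ρ T : ℝ → ℝ) (f : ℝ → ℝ → ℝ) : Prop :=
  Cwall κ T₁ * Cwall κ T₂ < 1 ∧
  IntegrableOn
    (fun y => ρ y * ∫ v in Ioi (0 : ℝ), Real.exp (-y / (κ * v)) * Mxw (T y) v)
    (Icc (0 : ℝ) 1) ∧
  IntegrableOn
    (fun y => ρ y * ∫ v in Ioi (0 : ℝ), Real.exp (-(1 - y) / (κ * v)) * Mxw (T y) v)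
    (Icc (0 : ℝ) 1) ∧
  (∀ x ∈ Icc (0 : ℝ) 1, ρ x = ∫ v, f x v) ∧
  (∀ x ∈ Icc (0 : ℝ) 1,
    (∀ᵐ v ∂(volume.restrict (Ioi (0 : ℝ))),
      f x v = Real.exp (-x / (κ * v)) * wallMxw T₁ v *
          ((Cminus κ ρ T + Cwall κ T₂ * Cplus κ ρ T) / (1 - Cwall κ T₁ * Cwall κ T₂)) +
        ∫ y in (0 : ℝ)..x, (κ * v)⁻¹ * Real.exp (-(x - y) / (κ * v)) * ρ y * Mxw (T y) v) ∧
    (∀ᵐ v ∂(volume.restrict (Iio (0 : ℝ))),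
      f x v = Real.exp (-(1 - x) / (κ * |v|)) * wallMxw T₂ v *
          ((Cplus κ ρ T + Cwall κ T₁ * Cminus κ ρ T) / (1 - Cwall κ T₁ * Cwall κ T₂)) +
        ∫ y in x..1, (κ * |v|)⁻¹ * Real.exp (-(y - x) / (κ * |v|)) * ρ y * Mxw (T y) v))

theorem setIntegral_Ioi_pos {f : ℝ → ℝ} (hf : IntegrableOn f (Ioi 0))
    (hpos : ∀ v, 0 < v → 0 < f v) : 0 < ∫ v in Ioi (0 : ℝ), f v := by
  rw [setIntegral_pos_iff_support_of_nonneg_ae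
    ((ae_restrict_iff' measurableSet_Ioi).2 (ae_of_all _ fun v hv => (hpos v hv).le)) hf]
  have hsub : Ioi (0 : ℝ) ⊆ Function.support f ∩ Ioi 0 := fun v hv => ⟨(hpos v hv).ne', hv⟩
  exact lt_of_lt_of_le (by simp) (measure_mono hsub)

theorem wallMxw_eq (T v : ℝ) : wallMxw T v = T⁻¹ * Real.exp (-(2 * T)⁻¹ * v ^ 2) := by
  unfold wallMxw
  congr 2
  ring

theorem wallMxw_pos {T : ℝ} (hT : 0 < T) (v : ℝ) : 0 < wallMxw T v :=
  mul_pos (inv_pos.2 hT) (Real.exp_pos _)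

theorem integrable_wallMxw {T : ℝ} (hT : 0 < T) : Integrable (wallMxw T) := by
  simp_rw [funext (wallMxw_eq T)]
  exact (integrable_exp_neg_mul_sq (by positivity)).const_mul _

theorem integrable_mul_wallMxw {T : ℝ} (hT : 0 < T) :
    Integrable fun v => v * wallMxw T v := by
  simp_rw [wallMxw_eq, mul_left_comm _ T⁻¹]
  exact (integrable_mul_exp_neg_mul_sq (by positivity)).const_mul _

theorem integral_Ioi_mul_wallMxw {T : ℝ} (hT : 0 < T) :
    ∫ v in Ioi (0 : ℝ), v * wallMxw T v = 1 := by
  simp_rw [wallMxw_eq, mul_left_comm _ T⁻¹]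
  rw [integral_const_mul]
  have h := integral_rpow_mul_exp_neg_mul_rpow (p := 2) (q := 1) (b := (2 * T)⁻¹)
    (by norm_num) (by norm_num) (by positivity)
  norm_num [Real.rpow_neg_one] at h
  norm_num
  rw [h]
  field_simp

theorem integral_Ioi_wallMxw {T : ℝ} (hT : 0 < T) :
    ∫ v in Ioi (0 : ℝ), wallMxw T v = √(π / 2) / √T := by
  simp_rw [wallMxw_eq]
  rw [integral_const_mul, integral_gaussian_Ioi, ← Real.sqrt_div (by positivity),
    show π / (2 * T)⁻¹ = (π / 2 / T) * (2 * T) ^ 2 by field_simp,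
    Real.sqrt_mul (by positivity), Real.sqrt_sq (by positivity)]
  field_simp

theorem exp_neg_one_div_lt_one {κ v : ℝ} (hκ : 0 < κ) (hv : 0 < v) :
    Real.exp (-1 / (κ * v)) < 1 :=
  Real.exp_lt_one_iff.2 (div_neg_of_neg_of_pos (by norm_num) (by positivity))

theorem integrableOn_Cwall {κ T : ℝ} (hκ : 0 < κ) (hT : 0 < T) :
    IntegrableOn (fun v => v * Real.exp (-1 / (κ * v)) * wallMxw T v) (Ioi 0) := by
  refine (integrable_mul_wallMxw hT).integrableOn.mono' ?_ ?_
  · unfold wallMxw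
    exact Measurable.aestronglyMeasurable (by fun_prop)
  · refine (ae_restrict_iff' measurableSet_Ioi).2 (ae_of_all _ fun v (hv : 0 < v) => ?_)
    have hM := wallMxw_pos hT v
    rw [Real.norm_of_nonneg (by positivity)]
    gcongr
    exact mul_le_of_le_one_right hv.le (exp_neg_one_div_lt_one hκ hv).le

theorem Cwall_pos {κ T : ℝ} (hκ : 0 < κ) (hT : 0 < T) : 0 < Cwall κ T :=
  setIntegral_Ioi_pos (integrableOn_Cwall hκ hT) fun v hv =>
    mul_pos (mul_pos hv (Real.exp_pos _)) (wallMxw_pos hT v)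

theorem one_sub_Cwall {κ T : ℝ} (hκ : 0 < κ) (hT : 0 < T) :
    1 - Cwall κ T = ∫ v in Ioi (0 : ℝ),
      (v * wallMxw T v - v * Real.exp (-1 / (κ * v)) * wallMxw T v) := by
  rw [integral_sub (integrable_mul_wallMxw hT).integrableOn (integrableOn_Cwall hκ hT),
    integral_Ioi_mul_wallMxw hT, Cwall]

theorem Cwall_lt_one {κ T : ℝ} (hκ : 0 < κ) (hT : 0 < T) : Cwall κ T < 1 := by
  rw [← sub_pos, one_sub_Cwall hκ hT]
  refine setIntegral_Ioi_pos
    ((integrable_mul_wallMxw hT).integrableOn.sub (integrableOn_Cwall hκ hT)) fun v hv => ?_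
  rw [← sub_mul]
  refine mul_pos ?_ (wallMxw_pos hT v)
  nlinarith [exp_neg_one_div_lt_one hκ hv]

theorem one_sub_Cwall_le {κ T : ℝ} (hκ : 0 < κ) (hT : 0 < T) :
    1 - Cwall κ T ≤ √(π / 2) * (1 / (κ * √T)) := by
  have hint : ∫ v in Ioi (0 : ℝ), κ⁻¹ * wallMxw T v = √(π / 2) * (1 / (κ * √T)) := by
    rw [integral_const_mul, integral_Ioi_wallMxw hT]
    field_simp
  rw [one_sub_Cwall hκ hT, ← hint]
  refine setIntegral_mono_on
    ((integrable_mul_wallMxw hT).integrableOn.sub (integrableOn_Cwall hκ hT))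
    ((integrable_wallMxw hT).integrableOn.const_mul _) measurableSet_Ioi fun v (hv : 0 < v) => ?_
  rw [← sub_mul]
  refine mul_le_mul_of_nonneg_right ?_ (wallMxw_pos hT v).le
  have hexp := mul_le_mul_of_nonneg_left (Real.add_one_le_exp (-1 / (κ * v))) hv.le
  have hcancel : v * (-1 / (κ * v) + 1) = v - κ⁻¹ := by
    field_simp
    ring
  linarith

/-- bounds on `C₁`, `C₂` and the lower bound on `1/(1 − C₁C₂)`. -/
theorem Cwall_bounds (κ T₁ T₂ : ℝ) (hκ : 0 < κ) (hT₁ : 0 < T₁) (hT₂ : 0 < T₂) :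
    0 < Cwall κ T₁ ∧ Cwall κ T₁ < 1 ∧ 0 < Cwall κ T₂ ∧ Cwall κ T₂ < 1 ∧
    1 - Cwall κ T₁ * Cwall κ T₂ ≤
      Real.sqrt (π / 2) * (1 / (κ * Real.sqrt T₁) + 1 / (κ * Real.sqrt T₂)) ∧
    Real.sqrt (2 / π) * (κ * Real.sqrt (T₁ * T₂) / (Real.sqrt T₁ + Real.sqrt T₂)) ≤
      1 / (1 - Cwall κ T₁ * Cwall κ T₂) := by
  have hp₁ := Cwall_pos hκ hT₁
  have hp₂ := Cwall_pos hκ hT₂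
  have hl₁ := Cwall_lt_one hκ hT₁
  have hl₂ := Cwall_lt_one hκ hT₂
  have hle : 1 - Cwall κ T₁ * Cwall κ T₂ ≤
      √(π / 2) * (1 / (κ * √T₁) + 1 / (κ * √T₂)) := by
    rw [mul_add]
    nlinarith [one_sub_Cwall_le hκ hT₁, one_sub_Cwall_le hκ hT₂,
      mul_pos (sub_pos.2 hl₁) (sub_pos.2 hl₂)]
  refine ⟨hp₁, hl₁, hp₂, hl₂, hle, ?_⟩
  have hpos : 0 < 1 - Cwall κ T₁ * Cwall κ T₂ := by nlinarith
  refine le_of_eq_of_le ?_ (one_div_le_one_div_of_le hpos hle)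
  have hinv : √(2 / π) = (√(π / 2))⁻¹ := by rw [← Real.sqrt_inv, inv_div]
  have hs₁ : 0 < √T₁ := Real.sqrt_pos.2 hT₁
  have hs₂ : 0 < √T₂ := Real.sqrt_pos.2 hT₂
  have hs : 0 < √(π / 2) := Real.sqrt_pos.2 (by positivity)
  rw [hinv, Real.sqrt_mul hT₁.le]
  generalize √(π / 2) = a at *
  field_simp
  ring
end

section
/- For all y ≥ 0, κ > 0 and T > 0, ∫₀^∞ (1 − e^{−y/(κv)}) M_T(v) dv ≤ 2 (2y²/(πκ²T))^{1/4}. -/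
open MeasureTheory Real Set

lemma Mxw_nonneg (T v : ℝ) : 0 ≤ Mxw T v := by
  unfold Mxw
  positivity

lemma Mxw_le (T v : ℝ) (hT : 0 < T) : Mxw T v ≤ (√(2 * π * T))⁻¹ := by
  unfold Mxw
  refine mul_le_of_le_one_right (by positivity) (Real.exp_le_one_iff.2 ?_)
  exact div_nonpos_of_nonpos_of_nonneg (by nlinarith [sq_nonneg v]) (by positivity)

lemma Mxw_eq_gaussian (T : ℝ) :
    Mxw T = fun v => (√(2 * π * T))⁻¹ * Real.exp (-(2 * T)⁻¹ * v ^ 2) := by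
  funext v
  unfold Mxw
  congr 2
  ring

lemma integrable_Mxw (T : ℝ) (hT : 0 < T) : Integrable (Mxw T) := by
  rw [Mxw_eq_gaussian]
  exact (integrable_exp_neg_mul_sq (by positivity)).const_mul _

lemma integral_Mxw_Ioi (T : ℝ) (hT : 0 < T) : ∫ v in Ioi (0 : ℝ), Mxw T v = 1 / 2 := by
  have h : π / (2 * T)⁻¹ = 2 * π * T := by
    rw [div_inv_eq_mul]
    ring
  rw [Mxw_eq_gaussian, integral_const_mul, integral_gaussian_Ioi, h]
  have : √(2 * π * T) ≠ 0 := by positivity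
  field_simp

/-- Splitting the velocities at `δ`: slow ones contribute at most `M_T(0) δ`, and fast ones at most
`a / δ` times the mass `1 / 2` of `M_T` on the half line. -/
lemma integral_one_sub_exp_mul_Mxw_le (y κ T δ : ℝ) (hy : 0 ≤ y) (hκ : 0 < κ) (hT : 0 < T)
    (hδ : 0 < δ) :
    (∫ v in Ioi (0 : ℝ), (1 - Real.exp (-y / (κ * v))) * Mxw T v) ≤
      (√(2 * π * T))⁻¹ * δ + y / (κ * δ) * (1 / 2) := by
  set c : ℝ := (√(2 * π * T))⁻¹ with hc
  have hc0 : 0 ≤ c := by positivity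
  have hM : Integrable (fun v => y / (κ * δ) * Mxw T v) (volume.restrict (Ioi (0 : ℝ))) :=
    ((integrable_Mxw T hT).integrableOn).const_mul _
  have hind : Integrable ((Iic δ).indicator fun _ => c) (volume.restrict (Ioi (0 : ℝ))) := by
    rw [integrable_indicator_iff measurableSet_Iic, IntegrableOn,
      Measure.restrict_restrict measurableSet_Iic, inter_comm, Ioi_inter_Iic]
    exact integrableOn_const (by simp)
  have hint : ∫ v in Ioi (0 : ℝ), ((Iic δ).indicator (fun _ => c) v + y / (κ * δ) * Mxw T v) =
      c * δ + y / (κ * δ) * (1 / 2) := by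
    rw [integral_add hind hM, integral_const_mul, integral_Mxw_Ioi T hT,
      setIntegral_indicator measurableSet_Iic, Ioi_inter_Iic, setIntegral_const]
    simp [hδ.le, mul_comm]
  rw [← hint]
  refine integral_mono_of_nonneg ?_ (hind.add hM) ?_
  · filter_upwards [ae_restrict_mem measurableSet_Ioi] with v hv
    have hv : 0 < v := hv
    refine mul_nonneg (sub_nonneg.2 (Real.exp_le_one_iff.2 ?_)) (Mxw_nonneg T v)
    exact div_nonpos_of_nonpos_of_nonneg (by linarith) (by positivity)
  · filter_upwards [ae_restrict_mem measurableSet_Ioi] with v hv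
    have hv : 0 < v := hv
    have hM0 := Mxw_nonneg T v
    by_cases hvδ : v ≤ δ
    · have h1 : (1 - Real.exp (-y / (κ * v))) * Mxw T v ≤ c :=
        (mul_le_of_le_one_left hM0 (by linarith [Real.exp_pos (-y / (κ * v))])).trans
          (Mxw_le T v hT)
      have h2 : 0 ≤ y / (κ * δ) * Mxw T v := by positivity
      simp only [indicator_of_mem (mem_Iic.2 hvδ)]
      linarith
    · simp only [indicator_of_notMem (fun h => hvδ (mem_Iic.1 h)), zero_add]
      refine mul_le_mul_of_nonneg_right ?_ hM0
      have h1 := Real.add_one_le_exp (-y / (κ * v))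
      have h2 : y / (κ * v) ≤ y / (κ * δ) := by
        have := (not_le.1 hvδ).le
        gcongr
      rw [neg_div] at h1 ⊢
      linarith

/-- `∫₀^∞ (1 − e^{−y/(κv)}) M_T(v) dv ≤ 2 (2y²/(πκ²T))^{1/4}`. -/
theorem maxwellian_exp_defect_bound (y κ T : ℝ) (hy : 0 ≤ y) (hκ : 0 < κ) (hT : 0 < T) :
    (∫ v in Ioi (0 : ℝ), (1 - Real.exp (-y / (κ * v))) * Mxw T v) ≤
      2 * (2 * y ^ 2 / (π * κ ^ 2 * T)) ^ ((1 : ℝ) / 4) := by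
  rcases hy.eq_or_lt with rfl | hy'
  · simp
  set c : ℝ := (√(2 * π * T))⁻¹ with hc
  have hc0 : 0 < c := by positivity
  have hR2 : (2 * y ^ 2 / (π * κ ^ 2 * T)) ^ ((1 : ℝ) / 4) = √(2 * (y / κ) * c) := by
    have h : 2 * y ^ 2 / (π * κ ^ 2 * T) = (2 * (y / κ) * c) ^ 2 := by
      rw [mul_pow, hc, inv_pow, Real.sq_sqrt (by positivity)]
      field_simp
    rw [h, ← Real.rpow_natCast, ← Real.rpow_mul (by positivity), Real.sqrt_eq_rpow]
    norm_num
  rw [hR2]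
  set R : ℝ := √(2 * (y / κ) * c) with hR
  have hR0 : 0 < R := by positivity
  have hRsq : R ^ 2 = 2 * (y / κ) * c := Real.sq_sqrt (by positivity)
  refine (integral_one_sub_exp_mul_Mxw_le y κ T (R / (2 * c)) hy hκ hT (by positivity)).trans ?_
  have h1 : c * (R / (2 * c)) = R / 2 := by field_simp
  have h2 : y / (κ * (R / (2 * c))) * (1 / 2) = R / 2 := by
    have : y / (κ * (R / (2 * c))) * (1 / 2) = 2 * (y / κ) * c / (2 * R) := by
      field_simp
    rw [this, ← hRsq]
    field_simp
  rw [h1, h2]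
  linarith
end
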